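/- Let α = [[a,b],[c,d]] be a 2r×2r complex matrix (blocks of size r) with α θ_{r,r} α* = μ θ_{r,r}, where θ_{r,r} = [[0,1_r],[−1_r,0]] and μ is a positive real number. Let x ∈ M_r(ℂ) be such that cx + d is invertible, and set y = (ax+b)(cx+d)⁻¹. Then i(y* − y) = μ · ((cx+d)⁻¹)* · i(x* − x) · (cx+d)⁻¹. In particular, i(y* − y) is positive definite if and only if i(x* − x) is positive definite. -/

import Mathlib

open Matrix
open scoped ComplexOrder

/-- For `θ = [[0, 1], [-1, 0]]`, the relation `α θ αᴴ = μ θ` with `μ ≠ 0` implies the dual relation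
`αᴴ θ α = μ θ`. -/
theorem conjTranspose_mul_theta_mul_self {n : Type*} [Fintype n] [DecidableEq n]
    {A : Matrix (n ⊕ n) (n ⊕ n) ℂ} {μ : ℂ} (hμ : μ ≠ 0)
    (h : A * fromBlocks (0 : Matrix n n ℂ) 1 (-1) 0 * Aᴴ =
      μ • fromBlocks (0 : Matrix n n ℂ) 1 (-1) 0) :
    Aᴴ * fromBlocks (0 : Matrix n n ℂ) 1 (-1) 0 * A =
      μ • fromBlocks (0 : Matrix n n ℂ) 1 (-1) 0 := by
  have hθ : (fromBlocks 0 1 (-1) 0 : Matrix (n ⊕ n) (n ⊕ n) ℂ) * fromBlocks 0 1 (-1) 0 = -1 := by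
    rw [fromBlocks_multiply, ← fromBlocks_one, fromBlocks_neg]
    simp
  generalize (fromBlocks 0 1 (-1) 0 : Matrix (n ⊕ n) (n ⊕ n) ℂ) = θ at h hθ ⊢
  have hright : A * (-μ⁻¹ • (θ * Aᴴ * θ)) = 1 := by
    rw [mul_smul_comm, ← mul_assoc, ← mul_assoc, h, smul_mul_assoc, hθ, smul_smul]
    simp [hμ]
  have hleft := mul_eq_one_comm.mp hright
  calc Aᴴ * θ * A = -(θ * θ) * (Aᴴ * θ * A) := by rw [hθ]; simp
    _ = μ • (θ * ((-μ⁻¹ • (θ * Aᴴ * θ)) * A)) := by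
      simp [smul_smul, hμ, mul_assoc]
    _ = μ • θ := by rw [hleft, mul_one]

/-- If `αᴴ θ α = μ θ` for `α = [[a, b], [c, d]]` and `θ = [[0, 1], [-1, 0]]`, then the columns
`α (x, 1)` satisfy `(ax + b)ᴴ (cx + d) - (cx + d)ᴴ (ax + b) = μ (xᴴ - x)`. -/
theorem conjTranspose_mul_sub_conjTranspose_mul {n : Type*} [Fintype n] [DecidableEq n]
    {a b c d : Matrix n n ℂ} {μ : ℂ}
    (h : (fromBlocks a b c d)ᴴ * fromBlocks (0 : Matrix n n ℂ) 1 (-1) 0 * fromBlocks a b c d =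
      μ • fromBlocks (0 : Matrix n n ℂ) 1 (-1) 0) (x : Matrix n n ℂ) :
    (a * x + b)ᴴ * (c * x + d) - (c * x + d)ᴴ * (a * x + b) = μ • (xᴴ - x) := by
  simp only [fromBlocks_conjTranspose, fromBlocks_multiply, fromBlocks_smul, fromBlocks_inj,
    mul_zero, mul_one, mul_neg, neg_mul, zero_add, add_zero, smul_zero, smul_neg] at h
  obtain ⟨h₁, h₂, h₃, h₄⟩ := h
  calc (a * x + b)ᴴ * (c * x + d) - (c * x + d)ᴴ * (a * x + b)
      = xᴴ * (-(cᴴ * a) + aᴴ * c) * x + xᴴ * (-(cᴴ * b) + aᴴ * d)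
        + (-(dᴴ * a) + bᴴ * c) * x + (-(dᴴ * b) + bᴴ * d) := by
        simp only [conjTranspose_add, conjTranspose_mul]
        noncomm_ring
    _ = μ • (xᴴ - x) := by
        rw [h₁, h₂, h₃, h₄]
        simp [sub_eq_add_neg]

/-- If `α = [[a,b],[c,d]]` satisfies `α θ_{r,r} αᴴ = μ θ_{r,r}` with `μ > 0`
real, and `c·x + d` is invertible, then with `y = (ax+b)(cx+d)⁻¹` one has
`i(yᴴ − y) = μ · ((cx+d)⁻¹)ᴴ · i(xᴴ − x) · (cx+d)⁻¹`; in particular `i(yᴴ − y)` is positive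
definite iff `i(xᴴ − x)` is. -/
theorem stmt_6 (r : ℕ) (a b c d : Matrix (Fin r) (Fin r) ℂ) (μ : ℝ) (hμ : 0 < μ)
    (hα : Matrix.fromBlocks a b c d * Matrix.fromBlocks (0 : Matrix (Fin r) (Fin r) ℂ) 1 (-1) 0 *
        (Matrix.fromBlocks a b c d)ᴴ =
      (μ : ℂ) • Matrix.fromBlocks (0 : Matrix (Fin r) (Fin r) ℂ) 1 (-1) 0)
    (x : Matrix (Fin r) (Fin r) ℂ) (hx : IsUnit (c * x + d)) :
    (Complex.I • (((a * x + b) * (c * x + d)⁻¹)ᴴ - (a * x + b) * (c * x + d)⁻¹) =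
        (μ : ℂ) • (((c * x + d)⁻¹)ᴴ * (Complex.I • (xᴴ - x)) * (c * x + d)⁻¹)) ∧
      ((Complex.I •
          (((a * x + b) * (c * x + d)⁻¹)ᴴ - (a * x + b) * (c * x + d)⁻¹)).PosDef ↔
        (Complex.I • (xᴴ - x)).PosDef) := by
  have hμ' : (μ : ℂ) ≠ 0 := by exact_mod_cast hμ.ne'
  have key := conjTranspose_mul_sub_conjTranspose_mul
    (conjTranspose_mul_theta_mul_self hμ' hα) x
  generalize a * x + b = p at key ⊢
  generalize c * x + d = q at key hx ⊢
  have hq : q * q⁻¹ = 1 := mul_nonsing_inv q ((isUnit_iff_isUnit_det q).mp hx)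
  have hq' : (q⁻¹)ᴴ * qᴴ = 1 := by rw [← conjTranspose_mul, hq, conjTranspose_one]
  have hdiff : (p * q⁻¹)ᴴ - p * q⁻¹ = (q⁻¹)ᴴ * (pᴴ * q - qᴴ * p) * q⁻¹ := by
    rw [mul_sub, sub_mul, ← mul_assoc, ← mul_assoc, hq', one_mul, mul_assoc _ q, hq, mul_one,
      conjTranspose_mul]
  have hmain : Complex.I • ((p * q⁻¹)ᴴ - p * q⁻¹) =
      (μ : ℂ) • ((q⁻¹)ᴴ * (Complex.I • (xᴴ - x)) * q⁻¹) := by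
    rw [hdiff, key]
    simp only [mul_smul_comm, smul_mul_assoc]
    rw [smul_comm]
  refine ⟨hmain, ?_⟩
  have hμpos : (0 : ℂ) < μ := by exact_mod_cast hμ
  have hinv : IsUnit q⁻¹ := (isUnit_nonsing_inv_iff).mpr hx
  rw [hmain, ← Matrix.IsUnit.posDef_star_left_conjugate_iff (x := Complex.I • (xᴴ - x)) hinv,
    star_eq_conjTranspose]
  refine ⟨fun h => ?_, fun h => h.smul hμpos⟩
  simpa [smul_smul, hμ'] using h.smul (inv_pos.mpr hμpos)
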